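/- For every integer n ≥ 0 and every m ∈ ℤ: | ∫_ℝ (χ⁻)⁽ⁿ⁾(x)·e(−mx) dx | ≤ 2·(β−α−ε)·(2/ε)ⁿ·M_ρ(n). -/

import Mathlib

open MeasureTheory

/-- `e(w) := exp(2πiw)`. -/
noncomputable def e (w : ℂ) : ℂ := Complex.exp (2 * Real.pi * Complex.I * w)

/-- `ℓ := ∫_{−1}^{1} exp(−1/(1−x²)) dx`. -/
noncomputable def ell : ℝ := ∫ x in (-1:ℝ)..1, Real.exp (-1 / (1 - x ^ 2))

/-- The standard mollifier `ρ`. -/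
noncomputable def rho (x : ℝ) : ℝ :=
  if |x| < 1 then ell⁻¹ * Real.exp (-1 / (1 - x ^ 2)) else 0

/-- `ρ_ε(x) := ε⁻¹·ρ(x/ε)`. -/
noncomputable def rhoScaled (ε : ℝ) (x : ℝ) : ℝ := ε⁻¹ * rho (x / ε)

/-- `M_ρ(n) := sup_x |ρ⁽ⁿ⁾(x)|`. -/
noncomputable def Mrho (n : ℕ) : ℝ := ⨆ x : ℝ, |iteratedDeriv n rho x|

/-- `χ⁻(x) := (χ_{[−r₋,r₋]} ∗ ρ_{ε/2})(x − (α+β)/2)` with `r₋ := (β−α−ε)/2`. -/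
noncomputable def chiMinus (α β ε : ℝ) (x : ℝ) : ℝ :=
  ∫ t : ℝ, (if |x - (α + β) / 2 - t| ≤ (β - α - ε) / 2 then (1:ℝ) else 0) *
    rhoScaled (ε / 2) t

open scoped ContDiff Convolution

theorem norm_e_of_im_eq_zero {w : ℂ} (hw : w.im = 0) : ‖e w‖ = 1 := by
  have hw' : w = (w.re : ℂ) := Complex.ext rfl (by simpa using hw)
  rw [e, hw', show 2 * Real.pi * Complex.I * (w.re : ℂ)
    = ((2 * Real.pi * w.re : ℝ) : ℂ) * Complex.I by push_cast; ring]
  exact Complex.norm_exp_ofReal_mul_I _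

theorem rho_eq_expNegInvGlue : rho = fun x => ell⁻¹ * expNegInvGlue (1 - x ^ 2) := by
  funext x
  have h : |x| < 1 ↔ ¬ 1 - x ^ 2 ≤ 0 := by
    rw [← sq_lt_one_iff_abs_lt_one, not_le, sub_pos]
  by_cases hx : |x| < 1
  · rw [rho, if_pos hx, expNegInvGlue, if_neg (h.1 hx), neg_div, one_div]
  · rw [rho, if_neg hx, expNegInvGlue, if_pos (not_not.1 (mt h.2 hx)), mul_zero]

theorem contDiff_rho : ContDiff ℝ ∞ rho := by
  rw [rho_eq_expNegInvGlue]
  have h : ContDiff ℝ ∞ expNegInvGlue := expNegInvGlue.contDiff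
  exact contDiff_const.mul (h.comp (by fun_prop))

theorem tsupport_rho_subset : tsupport rho ⊆ Set.Icc (-1) 1 := by
  refine closure_minimal (fun x hx => ?_) isClosed_Icc
  by_contra h
  refine hx (if_neg fun hx1 => h ?_)
  exact abs_le.1 hx1.le

theorem tsupport_iteratedDeriv_subset {F : Type*} [NormedAddCommGroup F] [NormedSpace ℝ F]
    (n : ℕ) (f : ℝ → F) : tsupport (iteratedDeriv n f) ⊆ tsupport f := by
  induction n with
  | zero => simp
  | succ n ih => exact iteratedDeriv_succ (f := f) ▸ tsupport_deriv_subset.trans ih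

theorem iteratedDeriv_rho_eq_zero (n : ℕ) {x : ℝ} (hx : x ∉ Set.Icc (-1 : ℝ) 1) :
    iteratedDeriv n rho x = 0 :=
  image_eq_zero_of_notMem_tsupport fun h =>
    hx (tsupport_rho_subset (tsupport_iteratedDeriv_subset n rho h))

theorem hasCompactSupport_rho : HasCompactSupport rho :=
  isCompact_Icc.of_isClosed_subset isClosed_closure tsupport_rho_subset

theorem HasCompactSupport.iteratedDeriv_real {F : Type*} [NormedAddCommGroup F]
    [NormedSpace ℝ F] {f : ℝ → F} (hf : HasCompactSupport f) (n : ℕ) :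
    HasCompactSupport (iteratedDeriv n f) :=
  hf.of_isClosed_subset isClosed_closure (tsupport_iteratedDeriv_subset n f)

theorem continuous_iteratedDeriv_rho (n : ℕ) : Continuous (iteratedDeriv n rho) :=
  contDiff_rho.continuous_iteratedDeriv n (by exact_mod_cast le_top)

theorem abs_iteratedDeriv_rho_le_Mrho (n : ℕ) (x : ℝ) : |iteratedDeriv n rho x| ≤ Mrho n := by
  obtain ⟨C, hC⟩ := (hasCompactSupport_rho.iteratedDeriv_real n).exists_bound_of_continuous
    (continuous_iteratedDeriv_rho n)
  exact le_ciSup (f := fun x => |iteratedDeriv n rho x|) ⟨C, by rintro _ ⟨y, rfl⟩; exact hC y⟩ x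

theorem integral_abs_iteratedDeriv_rho_le (n : ℕ) :
    ∫ x, |iteratedDeriv n rho x| ≤ 2 * Mrho n := by
  rw [← setIntegral_eq_integral_of_forall_compl_eq_zero (s := Set.Icc (-1 : ℝ) 1)
    fun x hx => by rw [iteratedDeriv_rho_eq_zero n hx, abs_zero]]
  refine (Real.le_norm_self _).trans ((norm_setIntegral_le_of_norm_le_const (C := Mrho n)
    (by simp) fun x _ => ?_).trans_eq ?_)
  · simpa using abs_iteratedDeriv_rho_le_Mrho n x
  · rw [Real.volume_real_Icc_of_le (by norm_num)]; ring

theorem rhoScaled_eq (δ : ℝ) : rhoScaled δ = fun x => δ⁻¹ * rho (δ⁻¹ * x) := by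
  funext x
  rw [rhoScaled, div_eq_inv_mul]

theorem contDiff_rhoScaled (δ : ℝ) : ContDiff ℝ ∞ (rhoScaled δ) := by
  rw [rhoScaled_eq]
  exact contDiff_const.mul (contDiff_rho.comp (by fun_prop))

theorem hasCompactSupport_rhoScaled {δ : ℝ} (hδ : δ ≠ 0) : HasCompactSupport (rhoScaled δ) := by
  rw [rhoScaled_eq]
  exact (hasCompactSupport_rho.comp_homeomorph (Homeomorph.mulLeft₀ _ (inv_ne_zero hδ))).mul_left

theorem iteratedDeriv_rhoScaled (δ : ℝ) (n : ℕ) :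
    iteratedDeriv n (rhoScaled δ) =
      fun x => δ⁻¹ * (δ⁻¹ ^ n * iteratedDeriv n rho (δ⁻¹ * x)) := by
  funext x
  rw [rhoScaled_eq, iteratedDeriv_const_mul_field,
    iteratedDeriv_comp_const_mul (contDiff_rho.of_le (by exact_mod_cast le_top))]

theorem integral_abs_iteratedDeriv_rhoScaled_le {δ : ℝ} (hδ : 0 < δ) (n : ℕ) :
    ∫ x, |iteratedDeriv n (rhoScaled δ) x| ≤ 2 * δ⁻¹ ^ n * Mrho n := by
  have hδ' : 0 < δ⁻¹ := inv_pos.2 hδ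
  simp_rw [iteratedDeriv_rhoScaled, abs_mul, abs_pow, abs_of_pos hδ']
  rw [integral_const_mul, integral_const_mul,
    Measure.integral_comp_mul_left (fun x => |iteratedDeriv n rho x|), inv_inv, abs_of_pos hδ,
    smul_eq_mul]
  calc δ⁻¹ * (δ⁻¹ ^ n * (δ * ∫ x, |iteratedDeriv n rho x|))
      = δ⁻¹ ^ n * ∫ x, |iteratedDeriv n rho x| := by field_simp
    _ ≤ δ⁻¹ ^ n * (2 * Mrho n) := by gcongr; exact integral_abs_iteratedDeriv_rho_le n
    _ = 2 * δ⁻¹ ^ n * Mrho n := by ring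

theorem iteratedDeriv_convolution_left {f g : ℝ → ℝ} (hf : ContDiff ℝ ∞ f)
    (hcf : HasCompactSupport f) (hg : LocallyIntegrable g) (n : ℕ) :
    iteratedDeriv n (f ⋆[ContinuousLinearMap.mul ℝ ℝ] g) =
      iteratedDeriv n f ⋆[ContinuousLinearMap.mul ℝ ℝ] g := by
  induction n generalizing f with
  | zero => simp
  | succ n ih =>
    have h : deriv (f ⋆[ContinuousLinearMap.mul ℝ ℝ] g) =
        deriv f ⋆[ContinuousLinearMap.mul ℝ ℝ] g := funext fun x =>
      (hcf.hasDerivAt_convolution_left _ (hf.of_le (by exact_mod_cast le_top)) hg x).deriv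
    rw [iteratedDeriv_succ', iteratedDeriv_succ', h, ih (contDiff_infty_iff_deriv.1 hf).2 hcf.deriv]

/-- Young's inequality in `L¹`. -/
theorem integral_abs_convolution_le {f g : ℝ → ℝ} (hf : Integrable f) (hg : Integrable g) :
    ∫ x, |(f ⋆[ContinuousLinearMap.mul ℝ ℝ] g) x| ≤ (∫ x, |f x|) * ∫ x, |g x| := by
  refine le_of_le_of_eq ?_
    (integral_convolution (ContinuousLinearMap.mul ℝ ℝ) hf.abs hg.abs)
  refine integral_mono (hf.integrable_convolution (ContinuousLinearMap.mul ℝ ℝ) hg).abs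
    (hf.abs.integrable_convolution (ContinuousLinearMap.mul ℝ ℝ) hg.abs) fun x => ?_
  calc |∫ t, f t * g (x - t)| ≤ ∫ t, |f t * g (x - t)| := abs_integral_le_integral_abs
    _ = ∫ t, |f t| * |g (x - t)| := by simp_rw [abs_mul]

theorem chiMinus_eq_convolution (α β ε : ℝ) :
    chiMinus α β ε = rhoScaled (ε / 2) ⋆[ContinuousLinearMap.mul ℝ ℝ]
      (Set.Icc (α + ε / 2) (β - ε / 2)).indicator 1 := by
  funext x
  rw [chiMinus, convolution_def]
  refine integral_congr_ae (Filter.Eventually.of_forall fun t => ?_)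
  have h : |x - (α + β) / 2 - t| ≤ (β - α - ε) / 2 ↔
      x - t ∈ Set.Icc (α + ε / 2) (β - ε / 2) := by
    rw [abs_le, Set.mem_Icc]
    constructor <;> rintro ⟨h1, h2⟩ <;> constructor <;> linarith
  simp [Set.indicator_apply, h]

/-- Fourier coefficient bound for the derivatives of `χ⁻`. -/
theorem stmt_13 (α β ε : ℝ) (hαβ : α < β) (hε0 : 0 < ε) (hε1 : ε < (β - α) / 2)
    (n : ℕ) (m : ℤ) :
    ‖∫ x : ℝ, Complex.ofReal (iteratedDeriv n (chiMinus α β ε) x) * e (-((m : ℂ) * (x : ℂ)))‖ ≤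
      2 * (β - α - ε) * (2 / ε) ^ n * Mrho n := by
  set G : ℝ → ℝ := (Set.Icc (α + ε / 2) (β - ε / 2)).indicator 1 with hG
  set f : ℝ → ℝ := iteratedDeriv n (rhoScaled (ε / 2)) with hf
  have hε : 0 < ε / 2 := half_pos hε0
  have hGi : Integrable G :=
    IntegrableOn.integrable_indicator (integrableOn_const (by simp)) measurableSet_Icc
  have hfi : Integrable f :=
    ((contDiff_rhoScaled _).continuous_iteratedDeriv n
      (by exact_mod_cast le_top)).integrable_of_hasCompactSupport
      ((hasCompactSupport_rhoScaled hε.ne').iteratedDeriv_real n)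
  have hGint : ∫ x, |G x| = β - α - ε := by
    have h : (fun x => |G x|) = G := funext fun x =>
      abs_of_nonneg (Set.indicator_nonneg (fun _ _ => zero_le_one) x)
    rw [h, hG, integral_indicator_one measurableSet_Icc, Real.volume_real_Icc_of_le (by linarith)]
    ring
  have hχ : iteratedDeriv n (chiMinus α β ε) = f ⋆[ContinuousLinearMap.mul ℝ ℝ] G := by
    rw [chiMinus_eq_convolution, iteratedDeriv_convolution_left (contDiff_rhoScaled _)
      (hasCompactSupport_rhoScaled hε.ne') hGi.locallyIntegrable]
  calc _ ≤ ∫ x : ℝ, ‖Complex.ofReal (iteratedDeriv n (chiMinus α β ε) x) *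
          e (-((m : ℂ) * (x : ℂ)))‖ := norm_integral_le_integral_norm _
    _ = ∫ x, |(f ⋆[ContinuousLinearMap.mul ℝ ℝ] G) x| := by
      refine integral_congr_ae (Filter.Eventually.of_forall fun x => ?_)
      simp only [hχ]
      rw [norm_mul, norm_e_of_im_eq_zero (by simp), mul_one, Complex.norm_real, Real.norm_eq_abs]
    _ ≤ (∫ x, |f x|) * ∫ x, |G x| := integral_abs_convolution_le hfi hGi
    _ ≤ (2 * (ε / 2)⁻¹ ^ n * Mrho n) * (β - α - ε) := by
      rw [hGint]
      exact mul_le_mul_of_nonneg_right (integral_abs_iteratedDeriv_rhoScaled_le hε n)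
        (by linarith)
    _ = 2 * (β - α - ε) * (2 / ε) ^ n * Mrho n := by
      rw [inv_div]
      ring
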